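/- Let μ be a Borel probability measure on (0,∞) with ∫₀^∞ v^{-3/2} μ(dv) < ∞, let φ(x) = ∫₀^∞ ρ_v(x) μ(dv), g = φ'/φ, and h(x) = (d²/dx²) log φ(x) − (1/x)(d/dx) log φ(x) for x ≠ 0. Then x² h(x) φ(x) and (1 + x g(x))² φ(x) are Lebesgue-integrable on ℝ and ∫_ℝ x² h(x) φ(x) dx = 2 − ∫_ℝ (1 + x g(x))² φ(x) dx. -/

import Mathlib

open MeasureTheory
open scoped ENNReal

/-- The density `ρ_v(x) = (2πv)^{-1/2} exp(−x²/(2v))` of the centered Gaussian law `N(0,v)`. -/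
noncomputable def gaussDens (v x : ℝ) : ℝ :=
  Real.exp (-(x ^ 2) / (2 * v)) / Real.sqrt (2 * Real.pi * v)

/-- The normal variance-mixture function `φ(x) = ∫₀^∞ ρ_v(x) μ(dv)`. -/
noncomputable def mixDens (μ : Measure ℝ) (x : ℝ) : ℝ :=
  ∫ v, gaussDens v x ∂μ

/-- `g(x) = φ'(x)/φ(x)`. -/
noncomputable def gFun (μ : Measure ℝ) (x : ℝ) : ℝ :=
  deriv (mixDens μ) x / mixDens μ x

/-- `h(x) = (log φ)''(x) − (1/x)(log φ)'(x)`. -/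
noncomputable def hFun (μ : Measure ℝ) (x : ℝ) : ℝ :=
  deriv (deriv (fun y => Real.log (mixDens μ y))) x
    - (1 / x) * deriv (fun y => Real.log (mixDens μ y)) x

open Topology ProbabilityTheory

/-- The weighted mixture `x ↦ ∫ v⁻ᵏ ρ_v(x) μ(dv)`. -/
noncomputable def invWeightedMixDens (μ : Measure ℝ) (k : ℕ) (x : ℝ) : ℝ :=
  ∫ v, (v⁻¹) ^ k * gaussDens v x ∂μ

lemma invWeightedMixDens_zero (μ : Measure ℝ) : invWeightedMixDens μ 0 = mixDens μ := by
  funext x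
  simp [invWeightedMixDens, mixDens]

lemma gaussDens_pos {v : ℝ} (hv : 0 < v) (x : ℝ) : 0 < gaussDens v x := by
  unfold gaussDens
  positivity

lemma measurable_uncurry_gaussDens : Measurable fun p : ℝ × ℝ => gaussDens p.2 p.1 := by
  unfold gaussDens
  fun_prop

lemma hasDerivAt_gaussDens (v x : ℝ) :
    HasDerivAt (gaussDens v) (-x * (v⁻¹ * gaussDens v x)) x := by
  have h : HasDerivAt (fun y : ℝ => -(y ^ 2) / (2 * v)) (-x * v⁻¹) x := by
    convert! (((hasDerivAt_id x).pow 2).neg.div_const (2 * v)) using 1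
    simp only [id, Nat.cast_ofNat]
    rcases eq_or_ne v 0 with rfl | hv
    · simp
    · field_simp
      simp
  convert! (h.exp.div_const (Real.sqrt (2 * Real.pi * v))) using 1
  unfold gaussDens
  ring

lemma gaussDens_le_of_abs_le {v x y : ℝ} (hv : 0 < v) (h : |y| ≤ |x|) :
    gaussDens v x ≤ gaussDens v y := by
  unfold gaussDens
  have := sq_le_sq.2 h
  gcongr

lemma ae_pos_of_measure_Iic_zero {μ : Measure ℝ} (hμ : μ (Set.Iic 0) = 0) :
    ∀ᵐ v ∂μ, 0 < v := by
  rw [ae_iff]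
  convert! hμ using 2
  ext v
  simp

/-- Away from the origin, `v⁻ᵏ ρ_v(x)` is bounded uniformly in `v > 0`. -/
lemma exists_inv_pow_mul_gaussDens_le (k : ℕ) {x : ℝ} (hx : x ≠ 0) :
    ∃ C, ∀ v, 0 < v → (v⁻¹) ^ k * gaussDens v x ≤ C := by
  have ha : 0 < x ^ 2 / 2 := by positivity
  set a := x ^ 2 / 2 with ha_def
  have hpow : ∀ n : ℕ, ∀ t : ℝ, 0 ≤ t →
      t ^ n * Real.exp (-(a * t)) ≤ (n.factorial : ℝ) / a ^ n := by
    intro n t ht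
    have h := Real.pow_div_factorial_le_exp (a * t) (by positivity) n
    rw [Real.exp_neg, ← div_eq_mul_inv, div_le_div_iff₀ (Real.exp_pos _) (by positivity)]
    rw [div_le_iff₀ (by positivity)] at h
    rw [mul_pow] at h
    linarith
  refine ⟨(k.factorial : ℝ) / a ^ k + ((k + 1).factorial : ℝ) / a ^ (k + 1), fun v hv => ?_⟩
  have ht : 0 < v⁻¹ := inv_pos.2 hv
  have hs : (Real.sqrt (2 * Real.pi * v))⁻¹ ≤ 1 + v⁻¹ := by
    rw [← Real.sqrt_inv]
    refine Real.sqrt_le_iff.2 ⟨by positivity, ?_⟩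
    have h1 : (2 * Real.pi * v)⁻¹ ≤ v⁻¹ := by
      gcongr
      nlinarith [Real.pi_gt_three]
    nlinarith
  have he : -(x ^ 2) / (2 * v) = -(a * v⁻¹) := by
    rw [ha_def]
    field_simp
  calc (v⁻¹) ^ k * gaussDens v x
      = (v⁻¹) ^ k * Real.exp (-(a * v⁻¹)) * (Real.sqrt (2 * Real.pi * v))⁻¹ := by
        rw [gaussDens, he]
        ring
    _ ≤ (v⁻¹) ^ k * Real.exp (-(a * v⁻¹)) * (1 + v⁻¹) := by gcongr
    _ = (v⁻¹) ^ k * Real.exp (-(a * v⁻¹)) + (v⁻¹) ^ (k + 1) * Real.exp (-(a * v⁻¹)) := by ring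
    _ ≤ _ := add_le_add (hpow k _ ht.le) (hpow (k + 1) _ ht.le)

lemma measurable_inv_pow_mul_gaussDens (k : ℕ) (x : ℝ) :
    Measurable fun v : ℝ => (v⁻¹) ^ k * gaussDens v x := by
  unfold gaussDens
  fun_prop

section

variable {μ : Measure ℝ} [IsProbabilityMeasure μ]

lemma integrable_inv_pow_mul_gaussDens (hμ : μ (Set.Iic 0) = 0) (k : ℕ) {x : ℝ} (hx : x ≠ 0) :
    Integrable (fun v => (v⁻¹) ^ k * gaussDens v x) μ := by
  obtain ⟨C, hC⟩ := exists_inv_pow_mul_gaussDens_le k hx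
  refine Integrable.of_bound (measurable_inv_pow_mul_gaussDens k x).aestronglyMeasurable C ?_
  filter_upwards [ae_pos_of_measure_Iic_zero hμ] with v hv
  have := gaussDens_pos hv x
  rw [Real.norm_of_nonneg (by positivity)]
  exact hC v hv

lemma mixDens_pos (hμ : μ (Set.Iic 0) = 0) {x : ℝ} (hx : x ≠ 0) : 0 < mixDens μ x := by
  have hpos := ae_pos_of_measure_Iic_zero hμ
  have hint := integrable_inv_pow_mul_gaussDens hμ 0 hx
  simp only [pow_zero, one_mul] at hint
  have hnn : 0 ≤ᵐ[μ] fun v => gaussDens v x := by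
    filter_upwards [hpos] with v hv using (gaussDens_pos hv x).le
  refine (integral_nonneg_of_ae hnn).lt_of_ne fun h => ?_
  have h0 := (integral_eq_zero_iff_of_nonneg_ae hnn hint).1 h.symm
  obtain ⟨v, hv, hv0⟩ := (hpos.and h0).exists
  exact (gaussDens_pos hv x).ne' hv0

lemma hasDerivAt_invWeightedMixDens (hμ : μ (Set.Iic 0) = 0) (k : ℕ) {x : ℝ} (hx : x ≠ 0) :
    HasDerivAt (invWeightedMixDens μ k) (-x * invWeightedMixDens μ (k + 1) x) x := by
  have hx' : 0 < |x| := abs_pos.2 hx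
  have hc : |x| / 2 ≠ 0 := by positivity
  have key := hasDerivAt_integral_of_dominated_loc_of_deriv_le (μ := μ)
    (F := fun y v => (v⁻¹) ^ k * gaussDens v y)
    (F' := fun y v => -y * ((v⁻¹) ^ (k + 1) * gaussDens v y))
    (bound := fun v => 2 * |x| * ((v⁻¹) ^ (k + 1) * gaussDens v (|x| / 2)))
    (Metric.ball_mem_nhds x (half_pos hx'))
    (.of_forall fun y => (measurable_inv_pow_mul_gaussDens k y).aestronglyMeasurable)
    (integrable_inv_pow_mul_gaussDens hμ k hx)
    ((measurable_inv_pow_mul_gaussDens (k + 1) x).const_mul (-x)).aestronglyMeasurable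
    ?_ ((integrable_inv_pow_mul_gaussDens hμ (k + 1) hc).const_mul _) ?_
  · have h := key.2
    rw [integral_const_mul] at h
    exact h
  · filter_upwards [ae_pos_of_measure_Iic_zero hμ] with v hv y hy
    rw [Metric.mem_ball, Real.dist_eq] at hy
    have h1 : |y| ≤ 2 * |x| := by
      have := abs_sub_abs_le_abs_sub y x
      linarith
    have h2 : |x| / 2 ≤ |y| := by
      have := abs_sub_abs_le_abs_sub x y
      rw [abs_sub_comm] at this
      linarith
    have h3 : gaussDens v y ≤ gaussDens v (|x| / 2) :=
      gaussDens_le_of_abs_le hv (by rwa [abs_of_pos (by positivity)])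
    have h4 := gaussDens_pos hv y
    rw [norm_mul, Real.norm_eq_abs, abs_neg, Real.norm_of_nonneg (by positivity)]
    gcongr
  · refine .of_forall fun v y _ => ?_
    convert! (hasDerivAt_gaussDens v y).const_mul ((v⁻¹) ^ k) using 1
    ring

lemma gFun_eq (hμ : μ (Set.Iic 0) = 0) {x : ℝ} (hx : x ≠ 0) :
    gFun μ x = -x * invWeightedMixDens μ 1 x / mixDens μ x := by
  have h := hasDerivAt_invWeightedMixDens hμ 0 hx
  rw [invWeightedMixDens_zero] at h
  rw [gFun, h.deriv]

lemma deriv_log_mixDens (hμ : μ (Set.Iic 0) = 0) {x : ℝ} (hx : x ≠ 0) :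
    deriv (fun y => Real.log (mixDens μ y)) x
      = -x * invWeightedMixDens μ 1 x / mixDens μ x := by
  have h := hasDerivAt_invWeightedMixDens hμ 0 hx
  rw [invWeightedMixDens_zero] at h
  exact (h.log (mixDens_pos hμ hx).ne').deriv

lemma hFun_mul_mixDens (hμ : μ (Set.Iic 0) = 0) {x : ℝ} (hx : x ≠ 0) :
    hFun μ x * mixDens μ x = x ^ 2 * invWeightedMixDens μ 2 x
      - x ^ 2 * invWeightedMixDens μ 1 x ^ 2 / mixDens μ x := by
  have hφ := (mixDens_pos hμ hx).ne'
  have h0 := hasDerivAt_invWeightedMixDens hμ 0 hx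
  rw [invWeightedMixDens_zero] at h0
  have h1 := hasDerivAt_invWeightedMixDens hμ 1 hx
  have hev : deriv (fun y => Real.log (mixDens μ y)) =ᶠ[𝓝 x]
      fun y => -y * invWeightedMixDens μ 1 y / mixDens μ y := by
    filter_upwards [isOpen_ne.mem_nhds hx] with y hy using deriv_log_mixDens hμ hy
  have h2 := (((hasDerivAt_id x).neg.mul h1).div h0 hφ).deriv
  have h3 : deriv (fun y => -y * invWeightedMixDens μ 1 y / mixDens μ y) x = _ := h2
  rw [hFun, hev.deriv_eq, deriv_log_mixDens hμ hx, h3]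
  simp only [Pi.neg_apply, Pi.mul_apply, id]
  field_simp
  ring

lemma sq_invWeightedMixDens_one_le (hμ : μ (Set.Iic 0) = 0) {x : ℝ} (hx : x ≠ 0) :
    invWeightedMixDens μ 1 x ^ 2 ≤ mixDens μ x * invWeightedMixDens μ 2 x := by
  have hφ := mixDens_pos hμ hx
  set φ := mixDens μ x with hφ_def
  set A := invWeightedMixDens μ 1 x
  set B := invWeightedMixDens μ 2 x
  have i0 := integrable_inv_pow_mul_gaussDens hμ 0 hx
  have i1 := integrable_inv_pow_mul_gaussDens hμ 1 hx
  have i2 := integrable_inv_pow_mul_gaussDens hμ 2 hx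
  have hnn : 0 ≤ ∫ v, (φ * v⁻¹ - A) ^ 2 * gaussDens v x ∂μ := by
    refine integral_nonneg_of_ae ?_
    filter_upwards [ae_pos_of_measure_Iic_zero hμ] with v hv
    have := gaussDens_pos hv x
    simp only [Pi.zero_apply]
    positivity
  have heq : ∫ v, (φ * v⁻¹ - A) ^ 2 * gaussDens v x ∂μ = φ * (φ * B - A ^ 2) := by
    have : (fun v => (φ * v⁻¹ - A) ^ 2 * gaussDens v x) = fun v =>
        φ ^ 2 * ((v⁻¹) ^ 2 * gaussDens v x) - 2 * φ * A * ((v⁻¹) ^ 1 * gaussDens v x)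
          + A ^ 2 * ((v⁻¹) ^ 0 * gaussDens v x) := by
      funext v
      ring
    have i21 : Integrable (fun v => φ ^ 2 * ((v⁻¹) ^ 2 * gaussDens v x)
        - 2 * φ * A * ((v⁻¹) ^ 1 * gaussDens v x)) μ := (i2.const_mul _).sub (i1.const_mul _)
    rw [this, integral_add i21 (i0.const_mul _),
      integral_sub (i2.const_mul _) (i1.const_mul _), integral_const_mul, integral_const_mul,
      integral_const_mul]
    change φ ^ 2 * B - 2 * φ * A * A + A ^ 2 * invWeightedMixDens μ 0 x = _
    rw [invWeightedMixDens_zero, ← hφ_def]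
    ring
  rw [heq] at hnn
  linarith [nonneg_of_mul_nonneg_right hnn hφ]

end

lemma integrable_pow_mul_gaussDens {v : ℝ} (hv : 0 < v) (n : ℕ) :
    Integrable fun x => x ^ n * gaussDens v x := by
  have h := (integrable_rpow_mul_exp_neg_mul_sq (b := (2 * v)⁻¹) (by positivity) (s := n)
    (by have : (0 : ℝ) ≤ n := n.cast_nonneg
        linarith)).mul_const (Real.sqrt (2 * Real.pi * v))⁻¹
  refine h.congr (.of_forall fun x => ?_)
  simp only [Real.rpow_natCast, gaussDens]
  rw [show -(2 * v)⁻¹ * x ^ 2 = -(x ^ 2) / (2 * v) by ring]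
  ring

lemma integral_gaussDens {v : ℝ} (hv : 0 < v) : ∫ x, gaussDens v x = 1 := by
  have hv' : (⟨v, hv.le⟩ : NNReal) ≠ 0 := fun h => hv.ne' (congrArg NNReal.toReal h)
  rw [← integral_gaussianPDFReal_eq_one 0 hv']
  congr 1
  funext x
  simp only [gaussDens, gaussianPDFReal, sub_zero]
  exact div_eq_inv_mul _ _

lemma integral_pow_add_two_mul_gaussDens {v : ℝ} (hv : 0 < v) (n : ℕ) :
    ∫ x, x ^ (n + 2) * gaussDens v x = (n + 1) * v * ∫ x, x ^ n * gaussDens v x := by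
  have i0 := integrable_pow_mul_gaussDens hv n
  have i2 := integrable_pow_mul_gaussDens hv (n + 2)
  have h := integral_eq_zero_of_hasDerivAt_of_integrable
    (f := fun x => x ^ (n + 1) * gaussDens v x)
    (f' := fun x => (n + 1) * (x ^ n * gaussDens v x) - v⁻¹ * (x ^ (n + 2) * gaussDens v x))
    (fun x => by
      convert! (hasDerivAt_pow (n + 1) x).mul (hasDerivAt_gaussDens v x) using 1
      push_cast
      ring)
    ((i0.const_mul _).sub (i2.const_mul _)) (integrable_pow_mul_gaussDens hv (n + 1))
  rw [integral_sub (i0.const_mul _) (i2.const_mul _), integral_const_mul, integral_const_mul] at h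
  field_simp at h
  linarith

lemma integral_pow_two_mul_mul_gaussDens {v : ℝ} (hv : 0 < v) (k : ℕ) :
    ∫ x, x ^ (2 * k) * ((v⁻¹) ^ k * gaussDens v x) = ∏ i ∈ Finset.range k, (2 * (i : ℝ) + 1) := by
  have hcomm : ∀ k : ℕ, ∫ x, x ^ (2 * k) * ((v⁻¹) ^ k * gaussDens v x)
      = (v⁻¹) ^ k * ∫ x, x ^ (2 * k) * gaussDens v x := fun k => by
    rw [← integral_const_mul]
    congr 1
    funext x
    ring
  induction k with
  | zero => simpa using integral_gaussDens hv
  | succ k ih =>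
    rw [Finset.prod_range_succ, ← ih, hcomm, hcomm, mul_add_one,
      integral_pow_add_two_mul_gaussDens hv]
    rw [pow_succ]
    field_simp
    push_cast
    ring

section

variable {μ : Measure ℝ} [IsProbabilityMeasure μ]

lemma integrable_prod_pow_mul_gaussDens (hμ : μ (Set.Iic 0) = 0) (k : ℕ) :
    Integrable (fun p : ℝ × ℝ => p.1 ^ (2 * k) * ((p.2⁻¹) ^ k * gaussDens p.2 p.1))
      ((volume : Measure ℝ).prod μ) := by
  have hpos := ae_pos_of_measure_Iic_zero hμ
  have hm : Measurable fun p : ℝ × ℝ => p.1 ^ (2 * k) * ((p.2⁻¹) ^ k * gaussDens p.2 p.1) := by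
    have := measurable_uncurry_gaussDens
    fun_prop
  refine (integrable_prod_iff' hm.aestronglyMeasurable).2 ⟨?_, ?_⟩
  · filter_upwards [hpos] with v hv
    refine ((integrable_pow_mul_gaussDens hv (2 * k)).const_mul ((v⁻¹) ^ k)).congr
      (.of_forall fun x => ?_)
    ring
  · refine (integrable_const (∏ i ∈ Finset.range k, (2 * (i : ℝ) + 1))).congr ?_
    filter_upwards [hpos] with v hv
    rw [← integral_pow_two_mul_mul_gaussDens hv k]
    congr 1
    funext x
    have := gaussDens_pos hv x
    rw [Real.norm_of_nonneg]
    rw [pow_mul]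
    positivity

lemma integrable_pow_mul_invWeightedMixDens (hμ : μ (Set.Iic 0) = 0) (k : ℕ) :
    Integrable fun x => x ^ (2 * k) * invWeightedMixDens μ k x := by
  refine (integrable_prod_pow_mul_gaussDens hμ k).integral_prod_left.congr
    (.of_forall fun x => ?_)
  simp only [integral_const_mul, invWeightedMixDens]

lemma integral_pow_mul_invWeightedMixDens (hμ : μ (Set.Iic 0) = 0) (k : ℕ) :
    ∫ x, x ^ (2 * k) * invWeightedMixDens μ k x = ∏ i ∈ Finset.range k, (2 * (i : ℝ) + 1) := by
  calc ∫ x, x ^ (2 * k) * invWeightedMixDens μ k x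
      = ∫ x, (∫ v, x ^ (2 * k) * ((v⁻¹) ^ k * gaussDens v x) ∂μ) := by
        simp only [integral_const_mul, invWeightedMixDens]
    _ = ∫ v, (∫ x, x ^ (2 * k) * ((v⁻¹) ^ k * gaussDens v x)) ∂μ :=
        integral_integral_swap
          (f := fun x v => x ^ (2 * k) * ((v⁻¹) ^ k * gaussDens v x))
          (integrable_prod_pow_mul_gaussDens hμ k)
    _ = ∫ _, ∏ i ∈ Finset.range k, (2 * (i : ℝ) + 1) ∂μ := by
        refine integral_congr_ae ?_
        filter_upwards [ae_pos_of_measure_Iic_zero hμ] with v hv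
          using integral_pow_two_mul_mul_gaussDens hv k
    _ = _ := by simp

lemma integrable_sq_invWeightedMixDens_one_div (hμ : μ (Set.Iic 0) = 0) :
    Integrable fun x => (x ^ 2 * invWeightedMixDens μ 1 x) ^ 2 / mixDens μ x := by
  have i0 := integrable_pow_mul_invWeightedMixDens hμ 0
  have i1 := integrable_pow_mul_invWeightedMixDens hμ 1
  simp only [mul_zero, pow_zero, one_mul, mul_one, invWeightedMixDens_zero] at i0 i1
  refine (integrable_pow_mul_invWeightedMixDens hμ 2).mono'
    ((i1.aemeasurable.pow_const 2).div i0.aemeasurable).aestronglyMeasurable ?_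
  filter_upwards [Measure.ae_ne volume (0 : ℝ)] with x hx
  have hφ := mixDens_pos hμ hx
  rw [Real.norm_of_nonneg (by positivity), div_le_iff₀ hφ]
  calc (x ^ 2 * invWeightedMixDens μ 1 x) ^ 2
      = x ^ (2 * 2) * invWeightedMixDens μ 1 x ^ 2 := by ring
    _ ≤ x ^ (2 * 2) * (mixDens μ x * invWeightedMixDens μ 2 x) := by
        refine mul_le_mul_of_nonneg_left (sq_invWeightedMixDens_one_le hμ hx) ?_
        rw [pow_mul]
        positivity
    _ = _ := by ring

end

/-- If `μ` is a Borel probability measure on `(0,∞)` with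
`∫ v^{-3/2} μ(dv) < ∞`, then `x² h(x) φ(x)` and `(1 + x g(x))² φ(x)` are
Lebesgue-integrable on `ℝ` and
`∫ x² h(x) φ(x) dx = 2 − ∫ (1 + x g(x))² φ(x) dx`. -/
theorem hFun_second_integral_identity (μ : Measure ℝ) [IsProbabilityMeasure μ]
    (hμ : μ (Set.Iic 0) = 0)
    (hmom : ∫⁻ v, ENNReal.ofReal (v ^ (-(3 / 2) : ℝ)) ∂μ < ⊤) :
    Integrable (fun x => x ^ 2 * hFun μ x * mixDens μ x) volume ∧
    Integrable (fun x => (1 + x * gFun μ x) ^ 2 * mixDens μ x) volume ∧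
    (∫ x : ℝ, x ^ 2 * hFun μ x * mixDens μ x)
      = 2 - ∫ x : ℝ, (1 + x * gFun μ x) ^ 2 * mixDens μ x := by
  have i0 := integrable_pow_mul_invWeightedMixDens hμ 0
  have i1 := integrable_pow_mul_invWeightedMixDens hμ 1
  have i2 := integrable_pow_mul_invWeightedMixDens hμ 2
  have m0 := integral_pow_mul_invWeightedMixDens hμ 0
  have m1 := integral_pow_mul_invWeightedMixDens hμ 1
  have m2 := integral_pow_mul_invWeightedMixDens hμ 2
  have iJ := integrable_sq_invWeightedMixDens_one_div hμ
  simp only [mul_zero, pow_zero, one_mul, mul_one, invWeightedMixDens_zero,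
    Finset.prod_range_succ, Finset.prod_range_zero, Nat.cast_zero, Nat.cast_one] at i0 i1 m0 m1 m2
  have hh : (fun x => x ^ (2 * 2) * invWeightedMixDens μ 2 x
      - (x ^ 2 * invWeightedMixDens μ 1 x) ^ 2 / mixDens μ x) =ᵐ[volume]
      fun x => x ^ 2 * hFun μ x * mixDens μ x := by
    filter_upwards [Measure.ae_ne volume (0 : ℝ)] with x hx
    rw [mul_assoc, hFun_mul_mixDens hμ hx]
    ring
  have hg : (fun x => mixDens μ x - 2 * (x ^ 2 * invWeightedMixDens μ 1 x)
      + (x ^ 2 * invWeightedMixDens μ 1 x) ^ 2 / mixDens μ x) =ᵐ[volume]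
      fun x => (1 + x * gFun μ x) ^ 2 * mixDens μ x := by
    filter_upwards [Measure.ae_ne volume (0 : ℝ)] with x hx
    have hφ := (mixDens_pos hμ hx).ne'
    rw [gFun_eq hμ hx]
    field_simp
    ring
  have i01 : Integrable fun x => mixDens μ x - 2 * (x ^ 2 * invWeightedMixDens μ 1 x) :=
    i0.sub (i1.const_mul 2)
  refine ⟨(i2.sub iJ).congr hh, (i01.add iJ).congr hg, ?_⟩
  rw [← integral_congr_ae hh, ← integral_congr_ae hg, integral_sub i2 iJ,
    integral_add i01 iJ, integral_sub i0 (i1.const_mul 2),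
    integral_const_mul, m0, m1, m2]
  ring
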